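/- Let (Z,ρ₀) be an antipodal space and let ρ₁, ρ₂ ∈ M(Z). Then (max over ξ∈Z of (dρ₂/dρ₁)(ξ)) · (min over ξ∈Z of (dρ₂/dρ₁)(ξ)) = 1; in particular d_M(ρ₁,ρ₂) = max_{ξ∈Z} log(dρ₂/dρ₁)(ξ) = − min_{ξ∈Z} log(dρ₂/dρ₁)(ξ). Moreover: (1) if ξ realizes the maximum of dρ₂/dρ₁ and η ∈ Z satisfies ρ₁(ξ,η)=1, then η realizes the minimum of dρ₂/dρ₁ and ρ₂(ξ,η)=ρ₁(ξ,η)=1; (2) if ξ' realizes the minimum of dρ₂/dρ₁ and η' ∈ Z satisfies ρ₂(ξ',η')=1, then η' realizes the maximum of dρ₂/dρ₁ and ρ₂(ξ',η')=ρ₁(ξ',η')=1. -/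

import Mathlib

open Filter Topology
open scoped Classical

variable {Z : Type*}

/-- `Z` has at least four points. -/
def HasFourPoints (Z : Type*) : Prop :=
  ∃ a b c d : Z, a ≠ b ∧ a ≠ c ∧ a ≠ d ∧ b ≠ c ∧ b ≠ d ∧ c ≠ d

/-- A separating function on `Z`: continuous, symmetric, and positive. -/
structure IsSeparating [TopologicalSpace Z] (ρ : Z → Z → ℝ) : Prop where
  continuous : Continuous fun p : Z × Z => ρ p.1 p.2
  symm : ∀ ξ η, ρ ξ η = ρ η ξ
  nonneg : ∀ ξ η, 0 ≤ ρ ξ η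
  eq_zero_iff : ∀ ξ η, ρ ξ η = 0 ↔ ξ = η

/-- The cross-ratio of a quadruple of points with respect to `ρ`. -/
noncomputable def crossRatio (ρ : Z → Z → ℝ) (ξ ξ' η η' : Z) : ℝ :=
  ρ ξ η * ρ ξ' η' / (ρ ξ η' * ρ ξ' η)

/-- Two functions are Moebius equivalent if their cross-ratios agree on all quadruples
of pairwise distinct points. -/
def MoebiusEquiv (ρ₁ ρ₂ : Z → Z → ℝ) : Prop :=
  ∀ ξ ξ' η η' : Z, ξ ≠ ξ' → ξ ≠ η → ξ ≠ η' → ξ' ≠ η → ξ' ≠ η' → η ≠ η' →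
    crossRatio ρ₁ ξ ξ' η η' = crossRatio ρ₂ ξ ξ' η η'

/-- An antipodal function on `Z`: a separating function with values in `[0,1]` such that
every point has an antipode. -/
structure IsAntipodal [TopologicalSpace Z] (ρ : Z → Z → ℝ) : Prop where
  toIsSeparating : IsSeparating ρ
  le_one : ∀ ξ η, ρ ξ η ≤ 1
  antipode : ∀ ξ, ∃ η, ρ ξ η = 1

/-- The Moebius space `M(Z, ρ₀)`: antipodal functions Moebius equivalent to `ρ₀`. -/
def MoebiusSpace [TopologicalSpace Z] (ρ₀ : Z → Z → ℝ) : Set (Z → Z → ℝ) :=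
  {ρ | IsAntipodal ρ ∧ MoebiusEquiv ρ₀ ρ}

/-- The derivative `dρ₂/dρ₁`: the (unique, when it exists) positive continuous function
satisfying the geometric mean value theorem
`ρ₂(ξ,η)² = f(ξ) f(η) ρ₁(ξ,η)²`. -/
noncomputable def mDeriv [TopologicalSpace Z] (ρ₁ ρ₂ : Z → Z → ℝ) : Z → ℝ :=
  if h : ∃ f : Z → ℝ, Continuous f ∧ (∀ ξ, 0 < f ξ) ∧
      ∀ ξ η, ρ₂ ξ η ^ 2 = f ξ * f η * ρ₁ ξ η ^ 2
  then h.choose else fun _ => 1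

/-- The metric `d_M(ρ₁, ρ₂) = ‖log (dρ₂/dρ₁)‖_∞` on the Moebius space. -/
noncomputable def dM [TopologicalSpace Z] (ρ₁ ρ₂ : Z → Z → ℝ) : ℝ :=
  ⨆ ξ : Z, |Real.log (mDeriv ρ₁ ρ₂ ξ)|

/-- The discrepancy function `D_{ρ₁}(τ)(ξ) = max_{η ≠ ξ} (τ(ξ) + τ(η) + log ρ₁(ξ,η)²)`. -/
noncomputable def discrepancy [TopologicalSpace Z] (ρ₁ : Z → Z → ℝ) (τ : C(Z, ℝ))
    (ξ : Z) : ℝ :=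
  ⨆ η : {η : Z // η ≠ ξ}, (τ ξ + τ η.1 + Real.log (ρ₁ ξ η.1 ^ 2))

/-- `E_{ρ₁}(τ)(ξ,η) = e^{τ(ξ)/2} e^{τ(η)/2} ρ₁(ξ,η)`. -/
noncomputable def eMap [TopologicalSpace Z] (ρ₁ : Z → Z → ℝ) (τ : C(Z, ℝ)) :
    Z → Z → ℝ :=
  fun ξ η => Real.exp (τ ξ / 2) * Real.exp (τ η / 2) * ρ₁ ξ η

/-- A solution of the `ρ₁`-antipodal flow `dτ_t/dt = -D_{ρ₁}(τ_t)` on `[0, ∞)`. -/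
def IsAntipodalFlowSol [TopologicalSpace Z] [CompactSpace Z]
    (ρ₁ : Z → Z → ℝ) (τ : ℝ → C(Z, ℝ)) : Prop :=
  ∀ t ∈ Set.Ici (0 : ℝ), ∃ τ' : C(Z, ℝ),
    (∀ ξ, τ' ξ = -discrepancy ρ₁ (τ t) ξ) ∧
    HasDerivWithinAt τ τ' (Set.Ici (0 : ℝ)) t

/-- The antipodalization map `P_∞(τ₀, ρ₁) = E_{ρ₁}(τ_∞)`, where `τ_∞` is the limit as
`t → ∞` of the solution of the `ρ₁`-antipodal flow starting at `τ₀`. -/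
noncomputable def antipodalization [TopologicalSpace Z] [CompactSpace Z]
    (ρ₁ : Z → Z → ℝ) (τ₀ : C(Z, ℝ)) : Z → Z → ℝ :=
  if h : ∃ p : (ℝ → C(Z, ℝ)) × C(Z, ℝ), p.1 0 = τ₀ ∧ IsAntipodalFlowSol ρ₁ p.1 ∧
      Filter.Tendsto p.1 Filter.atTop (𝓝 p.2)
  then eMap ρ₁ h.choose.2 else ρ₁


theorem HasFourPoints.exists_ne_ne (h4 : HasFourPoints Z) (x y : Z) : ∃ a, a ≠ x ∧ a ≠ y := by
  obtain ⟨a, b, c, d, hab, hac, had, hbc, hbd, hcd⟩ := h4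
  by_contra! h
  have h' : ∀ a, a = x ∨ a = y := fun a => or_iff_not_imp_left.2 (h a)
  rcases h' a with ha | ha <;> rcases h' b with hb | hb <;> rcases h' c with hc | hc <;>
    simp_all

theorem MoebiusEquiv.trans_of_left {ρ₀ ρ₁ ρ₂ : Z → Z → ℝ} (h₁ : MoebiusEquiv ρ₀ ρ₁)
    (h₂ : MoebiusEquiv ρ₀ ρ₂) : MoebiusEquiv ρ₁ ρ₂ := fun a b c d h h' h'' k k' l =>
  (h₁ a b c d h h' h'' k k' l).symm.trans (h₂ a b c d h h' h'' k k' l)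

theorem IsSeparating.pos [TopologicalSpace Z] {ρ : Z → Z → ℝ} (h : IsSeparating ρ) {ξ η : Z}
    (hne : ξ ≠ η) : 0 < ρ ξ η :=
  lt_of_le_of_ne (h.nonneg ξ η) fun h0 => hne ((h.eq_zero_iff ξ η).1 h0.symm)

/-- The ratio of two Moebius equivalent separating functions satisfies the exchange relation. -/
theorem MoebiusEquiv.ratio_mul_ratio [TopologicalSpace Z] {ρ₁ ρ₂ : Z → Z → ℝ}
    (h : MoebiusEquiv ρ₁ ρ₂) (h₁ : IsSeparating ρ₁) (h₂ : IsSeparating ρ₂) {a b c d : Z}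
    (hab : a ≠ b) (hac : a ≠ c) (had : a ≠ d) (hbc : b ≠ c) (hbd : b ≠ d) (hcd : c ≠ d) :
    ρ₂ a c / ρ₁ a c * (ρ₂ b d / ρ₁ b d) = ρ₂ a d / ρ₁ a d * (ρ₂ b c / ρ₁ b c) := by
  have key := h a b c d hab hac had hbc hbd hcd
  have p1 := h₁.pos hac
  have p2 := h₁.pos hbd
  have p3 := h₁.pos had
  have p4 := h₁.pos hbc
  have q3 := h₂.pos had
  have q4 := h₂.pos hbc
  unfold crossRatio at key
  rw [div_eq_div_iff (by positivity) (by positivity)] at key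
  rw [div_mul_div_comm, div_mul_div_comm, div_eq_div_iff (by positivity) (by positivity)]
  linarith

/-- A symmetric nonvanishing kernel satisfying the exchange relation determines a single value
`r ξ a * r ξ b / r a b` at each point `ξ`. -/
theorem exists_factor_of_exchange {r : Z → Z → ℝ} (h4 : HasFourPoints Z)
    (hsymm : ∀ a b, r a b = r b a) (hpos : ∀ a b, a ≠ b → 0 < r a b)
    (hex : ∀ a b c d : Z, a ≠ b → a ≠ c → a ≠ d → b ≠ c → b ≠ d → c ≠ d →
      r a c * r b d = r a d * r b c) (ξ : Z) :
    ∃ v : ℝ, ∀ a b, a ≠ ξ → b ≠ ξ → a ≠ b → v = r ξ a * r ξ b / r a b := by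
  have step : ∀ a b c, a ≠ ξ → b ≠ ξ → c ≠ ξ → a ≠ b → a ≠ c →
      r ξ a * r ξ b / r a b = r ξ a * r ξ c / r a c := by
    intro a b c ha hb hc hab hac
    rcases eq_or_ne b c with rfl | hbc
    · rfl
    have := hex ξ a b c ha.symm hb.symm hc.symm hab hac hbc
    rw [div_eq_div_iff (hpos a b hab).ne' (hpos a c hac).ne']
    linear_combination r ξ a * this
  have swap : ∀ a b, r ξ a * r ξ b / r a b = r ξ b * r ξ a / r b a := fun a b => by
    rw [mul_comm, hsymm a b]
  obtain ⟨p, hp, -⟩ := h4.exists_ne_ne ξ ξ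
  obtain ⟨q, hq, hqp⟩ := h4.exists_ne_ne ξ p
  refine ⟨r ξ p * r ξ q / r p q, fun a b ha hb hab => ?_⟩
  rcases eq_or_ne p a with rfl | hpa
  · exact step _ _ _ hp hq hb hqp.symm hab
  · rw [step p q a hp hq ha hqp.symm hpa, swap, step a p b ha hp hb hpa.symm hab]

/-- The geometric mean value theorem for Moebius equivalent separating functions. -/
theorem MoebiusEquiv.exists_deriv [TopologicalSpace Z] [T1Space Z] {ρ₁ ρ₂ : Z → Z → ℝ}
    (h : MoebiusEquiv ρ₁ ρ₂) (h4 : HasFourPoints Z) (h₁ : IsSeparating ρ₁)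
    (h₂ : IsSeparating ρ₂) :
    ∃ f : Z → ℝ, Continuous f ∧ (∀ ξ, 0 < f ξ) ∧
      ∀ ξ η, ρ₂ ξ η ^ 2 = f ξ * f η * ρ₁ ξ η ^ 2 := by
  set r : Z → Z → ℝ := fun a b => ρ₂ a b / ρ₁ a b with hr
  have hsymm : ∀ a b, r a b = r b a := fun a b => by simp only [hr, h₁.symm a b, h₂.symm a b]
  have hpos : ∀ a b, a ≠ b → 0 < r a b := fun a b hab => div_pos (h₂.pos hab) (h₁.pos hab)
  choose f hf using exists_factor_of_exchange h4 hsymm hpos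
    fun a b c d => h.ratio_mul_ratio h₁ h₂
  refine ⟨f, ?_, fun ξ => ?_, fun ξ η => ?_⟩
  · refine continuous_iff_continuousAt.2 fun ξ => ?_
    obtain ⟨p, hp, -⟩ := h4.exists_ne_ne ξ ξ
    obtain ⟨q, hq, hqp⟩ := h4.exists_ne_ne ξ p
    have hc : ∀ a, a ≠ ξ → ContinuousAt (fun x => r x a) ξ := fun a ha =>
      (h₂.continuous.comp (Continuous.prodMk_left a)).continuousAt.div
        (h₁.continuous.comp (Continuous.prodMk_left a)).continuousAt (h₁.pos ha.symm).ne'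
    refine (((hc p hp).mul (hc q hq)).div_const (r p q)).congr ?_
    filter_upwards [isOpen_ne.mem_nhds hp.symm, isOpen_ne.mem_nhds hq.symm] with x hxp hxq
    exact (hf x p q (Ne.symm hxp) (Ne.symm hxq) hqp.symm).symm
  · obtain ⟨p, hp, -⟩ := h4.exists_ne_ne ξ ξ
    obtain ⟨q, hq, hqp⟩ := h4.exists_ne_ne ξ p
    rw [hf ξ p q hp hq hqp.symm]
    exact div_pos (mul_pos (hpos _ _ hp.symm) (hpos _ _ hq.symm)) (hpos _ _ hqp.symm)
  · rcases eq_or_ne ξ η with rfl | hne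
    · simp [(h₁.eq_zero_iff ξ ξ).2 rfl, (h₂.eq_zero_iff ξ ξ).2 rfl]
    obtain ⟨a, haξ, haη⟩ := h4.exists_ne_ne ξ η
    have hprod : f ξ * f η = r ξ η ^ 2 := by
      rw [hf ξ η a hne.symm haξ haη.symm, hf η ξ a hne haη haξ.symm, hsymm η ξ]
      have := (hpos η a haη.symm).ne'
      have := (hpos ξ a haξ.symm).ne'
      field_simp
    have := (h₁.pos hne).ne'
    rw [hprod, hr]
    field_simp

theorem mDeriv_spec [TopologicalSpace Z] {ρ₁ ρ₂ : Z → Z → ℝ}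
    (h : ∃ f : Z → ℝ, Continuous f ∧ (∀ ξ, 0 < f ξ) ∧
      ∀ ξ η, ρ₂ ξ η ^ 2 = f ξ * f η * ρ₁ ξ η ^ 2) :
    Continuous (mDeriv ρ₁ ρ₂) ∧ (∀ ξ, 0 < mDeriv ρ₁ ρ₂ ξ) ∧
      ∀ ξ η, ρ₂ ξ η ^ 2 = mDeriv ρ₁ ρ₂ ξ * mDeriv ρ₁ ρ₂ η * ρ₁ ξ η ^ 2 := by
  unfold mDeriv
  rw [dif_pos h]
  exact h.choose_spec

theorem ciSup_eq_of_forall_le {α : Type*} {g : α → ℝ} {x : α} (h : ∀ y, g y ≤ g x) :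
    ⨆ y, g y = g x :=
  IsGreatest.csSup_eq ⟨⟨x, rfl⟩, Set.forall_mem_range.2 h⟩

theorem ciInf_eq_of_forall_le {α : Type*} {g : α → ℝ} {x : α} (h : ∀ y, g x ≤ g y) :
    ⨅ y, g y = g x :=
  IsLeast.csInf_eq ⟨⟨x, rfl⟩, Set.forall_mem_range.2 h⟩

theorem statement3 [TopologicalSpace Z] [CompactSpace Z]
    [TopologicalSpace.MetrizableSpace Z] (h4 : HasFourPoints Z)
    (ρ₀ : Z → Z → ℝ) (h₀ : IsAntipodal ρ₀)
    (ρ₁ ρ₂ : Z → Z → ℝ) (hρ₁ : ρ₁ ∈ MoebiusSpace ρ₀) (hρ₂ : ρ₂ ∈ MoebiusSpace ρ₀) :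
    (⨆ ξ : Z, mDeriv ρ₁ ρ₂ ξ) * (⨅ ξ : Z, mDeriv ρ₁ ρ₂ ξ) = 1 ∧
    dM ρ₁ ρ₂ = ⨆ ξ : Z, Real.log (mDeriv ρ₁ ρ₂ ξ) ∧
    dM ρ₁ ρ₂ = -(⨅ ξ : Z, Real.log (mDeriv ρ₁ ρ₂ ξ)) ∧
    (∀ ξ η : Z, (∀ ζ, mDeriv ρ₁ ρ₂ ζ ≤ mDeriv ρ₁ ρ₂ ξ) → ρ₁ ξ η = 1 →
      (∀ ζ, mDeriv ρ₁ ρ₂ η ≤ mDeriv ρ₁ ρ₂ ζ) ∧ ρ₂ ξ η = 1) ∧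
    (∀ ξ' η' : Z, (∀ ζ, mDeriv ρ₁ ρ₂ ξ' ≤ mDeriv ρ₁ ρ₂ ζ) → ρ₂ ξ' η' = 1 →
      (∀ ζ, mDeriv ρ₁ ρ₂ ζ ≤ mDeriv ρ₁ ρ₂ η') ∧ ρ₁ ξ' η' = 1) := by
  rcases hρ₁ with ⟨a₁, e₁⟩
  rcases hρ₂ with ⟨a₂, e₂⟩
  obtain ⟨hcont, hpos, hmv⟩ := mDeriv_spec
    ((e₁.trans_of_left e₂).exists_deriv h4 a₁.toIsSeparating a₂.toIsSeparating)
  unfold dM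
  set f := mDeriv ρ₁ ρ₂
  have hle : ∀ ξ η, ρ₁ ξ η = 1 → f ξ * f η ≤ 1 := fun ξ η h => by
    have := hmv ξ η
    rw [h, one_pow, mul_one] at this
    rw [← this]
    exact pow_le_one₀ (a₂.toIsSeparating.nonneg _ _) (a₂.le_one _ _)
  have hge : ∀ ξ η, ρ₂ ξ η = 1 → 1 ≤ f ξ * f η := fun ξ η h => by
    have := hmv ξ η
    rw [h, one_pow] at this
    rw [this]
    exact mul_le_of_le_one_right (mul_pos (hpos _) (hpos _)).le
      (pow_le_one₀ (a₁.toIsSeparating.nonneg _ _) (a₁.le_one _ _))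
  have hmm : ∀ p q, (∀ ζ, f ζ ≤ f p) → (∀ ζ, f q ≤ f ζ) → f p * f q = 1 := by
    intro p q hp hq
    obtain ⟨p', hp'⟩ := a₁.antipode p
    obtain ⟨q', hq'⟩ := a₂.antipode q
    apply le_antisymm
    · exact (mul_le_mul_of_nonneg_left (hq p') (hpos p).le).trans (hle p p' hp')
    · rw [mul_comm]
      exact (hge q q' hq').trans (mul_le_mul_of_nonneg_left (hp q') (hpos q).le)
  have : Nonempty Z := ⟨h4.choose⟩
  obtain ⟨p, -, hp'⟩ := isCompact_univ.exists_isMaxOn Set.univ_nonempty hcont.continuousOn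
  obtain ⟨q, -, hq'⟩ := isCompact_univ.exists_isMinOn Set.univ_nonempty hcont.continuousOn
  have hp : ∀ ζ, f ζ ≤ f p := fun ζ => hp' (Set.mem_univ ζ)
  have hq : ∀ ζ, f q ≤ f ζ := fun ζ => hq' (Set.mem_univ ζ)
  have hlogp : ∀ ζ, Real.log (f ζ) ≤ Real.log (f p) := fun ζ => Real.log_le_log (hpos ζ) (hp ζ)
  have hlogq : ∀ ζ, Real.log (f q) ≤ Real.log (f ζ) := fun ζ => Real.log_le_log (hpos q) (hq ζ)
  have hlog : Real.log (f p) = -Real.log (f q) := by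
    rw [eq_neg_iff_add_eq_zero, ← Real.log_mul (hpos p).ne' (hpos q).ne', hmm p q hp hq,
      Real.log_one]
  have habsp : |Real.log (f p)| = Real.log (f p) := abs_of_nonneg (by linarith [hlogp q])
  have habs : ⨆ ξ, |Real.log (f ξ)| = Real.log (f p) := by
    rw [← habsp]
    refine ciSup_eq_of_forall_le (g := fun ξ => |Real.log (f ξ)|) fun ζ => ?_
    simp only [habsp]
    exact abs_le.2 ⟨by linarith [hlogq ζ], hlogp ζ⟩
  refine ⟨?_, ?_, ?_, fun ξ η hξ h => ?_, fun ξ η hξ h => ?_⟩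
  · rw [ciSup_eq_of_forall_le hp, ciInf_eq_of_forall_le hq, hmm p q hp hq]
  · rw [habs, ciSup_eq_of_forall_le hlogp]
  · rw [habs, ciInf_eq_of_forall_le hlogq, hlog]
  · have hηq : f η ≤ f q :=
      le_of_mul_le_mul_left ((hle ξ η h).trans_eq (hmm ξ q hξ hq).symm) (hpos ξ)
    have hη : ∀ ζ, f η ≤ f ζ := fun ζ => hηq.trans (hq ζ)
    have := hmv ξ η
    rw [hmm ξ η hξ hη, h, one_pow, mul_one] at this
    exact ⟨hη, (pow_eq_one_iff_of_nonneg (a₂.toIsSeparating.nonneg _ _) two_ne_zero).1 this⟩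
  · have hpη : f p ≤ f η :=
      le_of_mul_le_mul_left (((mul_comm _ _).trans (hmm p ξ hp hξ)).trans_le (hge ξ η h)) (hpos ξ)
    have hη : ∀ ζ, f ζ ≤ f η := fun ζ => (hp ζ).trans hpη
    have := hmv ξ η
    rw [mul_comm (f ξ), hmm η ξ hη hξ, h, one_pow, one_mul] at this
    exact ⟨hη, (pow_eq_one_iff_of_nonneg (a₁.toIsSeparating.nonneg _ _) two_ne_zero).1 this.symm⟩
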